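/- arXiv:2011.13234 — 5 statements merged into one kernel-verified Lean document; each statement's English description precedes it below -/
import Mathlib

section
/- Pointwise lifting of data transformations is continuous on prefix-chains: for any f : α → β and any prefix-chain c : ℕ → Stream'.Seq α with least upper bound s, the sequence Seq.map f s is the least upper bound of the prefix-chain n ↦ Seq.map f (c n). Similarly, if c and d are prefix-chains with least upper bounds s and t respectively, then Seq.zip s t is the least upper bound of the prefix-chain n ↦ Seq.zip (c n) (d n). -/
/-- The prefix order on finite-or-infinite sequences. -/
def SeqPrefix {α : Type*} (x y : Stream'.Seq α) : Prop :=
  ∀ n a, x.get? n = some a → y.get? n = some a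

/-- `s` is the least upper bound of the chain `c` (pointwise characterization). -/
def IsSeqLub {α : Type*} (c : ℕ → Stream'.Seq α) (s : Stream'.Seq α) : Prop :=
  ∀ n a, s.get? n = some a ↔ ∃ m, (c m).get? n = some a

theorem SeqPrefix.map {α β : Type*} (f : α → β) {x y : Stream'.Seq α} (h : SeqPrefix x y) :
    SeqPrefix (x.map f) (y.map f) := by
  intro n b hb
  rw [Stream'.Seq.map_get?, Option.map_eq_some_iff] at hb ⊢
  obtain ⟨a, ha, rfl⟩ := hb
  exact ⟨a, h n a ha, rfl⟩

theorem SeqPrefix.zip {α β : Type*} {x x' : Stream'.Seq α} {y y' : Stream'.Seq β}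
    (hx : SeqPrefix x x') (hy : SeqPrefix y y') : SeqPrefix (x.zip y) (x'.zip y') := by
  intro n p hp
  rw [Stream'.Seq.get?_zip, Option.map₂_eq_some_iff] at hp ⊢
  obtain ⟨a, b, ha, hb, rfl⟩ := hp
  exact ⟨a, b, hx n a ha, hy n b hb, rfl⟩

theorem SeqPrefix.of_le {α : Type*} {c : ℕ → Stream'.Seq α}
    (hc : ∀ n, SeqPrefix (c n) (c (n + 1))) {m k : ℕ} (hmk : m ≤ k) :
    SeqPrefix (c m) (c k) := by
  induction hmk with
  | refl => exact fun _ _ h => h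
  | step _ ih => exact fun n a h => hc _ n a (ih n a h)

theorem IsSeqLub.prefix_lub {α : Type*} {c : ℕ → Stream'.Seq α} {s : Stream'.Seq α}
    (h : IsSeqLub c s) (m : ℕ) : SeqPrefix (c m) s :=
  fun n a ha => (h n a).2 ⟨m, ha⟩

theorem IsSeqLub.map {α β : Type*} (f : α → β) {c : ℕ → Stream'.Seq α} {s : Stream'.Seq α}
    (h : IsSeqLub c s) : IsSeqLub (fun n => (c n).map f) (s.map f) := by
  refine fun n b => ⟨fun hb => ?_, fun ⟨m, hm⟩ => (h.prefix_lub m).map f n b hm⟩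
  rw [Stream'.Seq.map_get?, Option.map_eq_some_iff] at hb
  obtain ⟨a, ha, rfl⟩ := hb
  obtain ⟨m, hm⟩ := (h n a).1 ha
  exact ⟨m, by rw [Stream'.Seq.map_get?, hm, Option.map_some]⟩

theorem IsSeqLub.zip {α β : Type*} {c : ℕ → Stream'.Seq α} {d : ℕ → Stream'.Seq β}
    {s : Stream'.Seq α} {t : Stream'.Seq β}
    (hc : ∀ n, SeqPrefix (c n) (c (n + 1))) (hs : IsSeqLub c s)
    (hd : ∀ n, SeqPrefix (d n) (d (n + 1))) (ht : IsSeqLub d t) :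
    IsSeqLub (fun n => (c n).zip (d n)) (s.zip t) := by
  refine fun n p => ⟨fun hp => ?_,
    fun ⟨m, hm⟩ => (hs.prefix_lub m).zip (ht.prefix_lub m) n p hm⟩
  rw [Stream'.Seq.get?_zip, Option.map₂_eq_some_iff] at hp
  obtain ⟨a, b, ha, hb, rfl⟩ := hp
  obtain ⟨i, hi⟩ := (hs n a).1 ha
  obtain ⟨j, hj⟩ := (ht n b).1 hb
  refine ⟨max i j, ?_⟩
  rw [Stream'.Seq.get?_zip, SeqPrefix.of_le hc (le_max_left i j) n a hi,
    SeqPrefix.of_le hd (le_max_right i j) n b hj, Option.map₂_some_some]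

/-- Pointwise lifting of data transformations is continuous on prefix-chains:
`Seq.map f` and `Seq.zip` map least upper bounds of chains to least upper
bounds of the image chains. -/
theorem map_zip_continuous {α β : Type*} :
    (∀ (f : α → β) (c : ℕ → Stream'.Seq α) (s : Stream'.Seq α),
      (∀ n, SeqPrefix (c n) (c (n + 1))) → IsSeqLub c s →
      (∀ n, SeqPrefix ((c n).map f) ((c (n + 1)).map f)) ∧
      IsSeqLub (fun n => (c n).map f) (s.map f)) ∧
    (∀ (c : ℕ → Stream'.Seq α) (d : ℕ → Stream'.Seq β)
        (s : Stream'.Seq α) (t : Stream'.Seq β),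
      (∀ n, SeqPrefix (c n) (c (n + 1))) → IsSeqLub c s →
      (∀ n, SeqPrefix (d n) (d (n + 1))) → IsSeqLub d t →
      (∀ n, SeqPrefix ((c n).zip (d n)) ((c (n + 1)).zip (d (n + 1)))) ∧
      IsSeqLub (fun n => (c n).zip (d n)) (s.zip t)) := by
  exact ⟨fun f _ _ hc hs => ⟨fun n => (hc n).map f, hs.map f⟩,
    fun _ _ _ _ hc hs hd ht => ⟨fun n => (hc n).zip (hd n), hs.zip hc hd ht⟩⟩
end

section
/- Kahn continuity criterion: let f : Stream'.Seq α → Stream'.Seq β be monotone with respect to the prefix order and finitely determined, meaning that for every x, n, and b with (f x).get? n = some b there exists a finite sequence p (i.e., p.get? m = none for some m) with p ⊑ x and (f p).get? n = some b. Then f is continuous on prefix-chains: for every prefix-chain c with least upper bound s, f s is the least upper bound of the prefix-chain n ↦ f (c n). -/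
theorem SeqPrefix.trans {α : Type*} {x y z : Stream'.Seq α}
    (hxy : SeqPrefix x y) (hyz : SeqPrefix y z) : SeqPrefix x z :=
  fun n a h => hyz n a (hxy n a h)

theorem seqPrefix_of_le {α : Type*} {c : ℕ → Stream'.Seq α}
    (hc : ∀ n, SeqPrefix (c n) (c (n + 1))) {i j : ℕ} (hij : i ≤ j) :
    SeqPrefix (c i) (c j) := by
  induction hij with
  | refl => exact fun _ _ h => h
  | step _ ih => exact ih.trans (hc _)

theorem IsSeqLub.seqPrefix {α : Type*} {c : ℕ → Stream'.Seq α} {s : Stream'.Seq α}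
    (hs : IsSeqLub c s) (m : ℕ) : SeqPrefix (c m) s :=
  fun n a h => (hs n a).2 ⟨m, h⟩

/-- Finite sequences are compact elements for the prefix order. -/
theorem IsSeqLub.exists_seqPrefix {α : Type*} {c : ℕ → Stream'.Seq α} {s p : Stream'.Seq α}
    (hs : IsSeqLub c s) (hc : ∀ n, SeqPrefix (c n) (c (n + 1)))
    (hp : ∃ m, p.get? m = none) (hps : SeqPrefix p s) : ∃ k, SeqPrefix p (c k) := by
  obtain ⟨m, hm⟩ := hp
  have bounded : ∀ l, ∃ k, ∀ n < l, ∀ a, p.get? n = some a → (c k).get? n = some a := by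
    intro l
    induction l with
    | zero => exact ⟨0, fun n hn => absurd hn n.not_lt_zero⟩
    | succ l ih =>
      obtain ⟨k, hk⟩ := ih
      cases hl : p.get? l with
      | none =>
        refine ⟨k, fun n hn a ha => ?_⟩
        rcases Nat.lt_succ_iff_lt_or_eq.1 hn with h | rfl
        · exact hk n h a ha
        · simp [hl] at ha
      | some b =>
        obtain ⟨j, hj⟩ := (hs l b).1 (hps l b hl)
        refine ⟨max k j, fun n hn a ha => ?_⟩
        rcases Nat.lt_succ_iff_lt_or_eq.1 hn with h | rfl
        · exact seqPrefix_of_le hc (le_max_left k j) n a (hk n h a ha)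
        · obtain rfl : b = a := Option.some.inj (hl.symm.trans ha)
          exact seqPrefix_of_le hc (le_max_right k j) n b hj
  obtain ⟨k, hk⟩ := bounded m
  refine ⟨k, fun n a ha => hk n ?_ a ha⟩
  by_contra! hmn
  simp [Stream'.Seq.le_stable p hmn hm] at ha

/-- Kahn continuity criterion: a monotone, finitely determined stream function
(each output element depends only on a finite prefix of the input) is
continuous on prefix-chains. -/
theorem kahn_continuity_criterion {α β : Type*}
    (f : Stream'.Seq α → Stream'.Seq β)
    (hmono : ∀ x y, SeqPrefix x y → SeqPrefix (f x) (f y))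
    (hfin : ∀ (x : Stream'.Seq α) (n : ℕ) (b : β), (f x).get? n = some b →
      ∃ p : Stream'.Seq α, (∃ m, p.get? m = none) ∧ SeqPrefix p x ∧
        (f p).get? n = some b)
    (c : ℕ → Stream'.Seq α) (hc : ∀ n, SeqPrefix (c n) (c (n + 1)))
    (s : Stream'.Seq α) (hs : IsSeqLub c s) :
    (∀ n, SeqPrefix (f (c n)) (f (c (n + 1)))) ∧
    IsSeqLub (fun n => f (c n)) (f s) := by
  refine ⟨fun n => hmono _ _ (hc n), fun n b => ⟨fun h => ?_, ?_⟩⟩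
  · obtain ⟨p, hp, hps, hpb⟩ := hfin s n b h
    obtain ⟨k, hk⟩ := hs.exists_seqPrefix hc hp hps
    exact ⟨k, hmono _ _ hk n b hpb⟩
  · rintro ⟨m, hm⟩
    exact hmono _ _ (hs.seqPrefix m) n b hm
end

section
/- Well-definedness and timing determinism of the 'ready' function: let P : ℕ → ℝ be monotone (nondecreasing) with Filter.Tendsto P Filter.atTop Filter.atTop (the release pattern), and let R : ℕ → ℝ be arbitrary (the data-ready times). Define j : ℕ → ℕ recursively by: j 0 is the least m with P m ≥ R 0, and j (n+1) is the least m > j n with P m ≥ R (n+1). Then: (a) these least indices exist for every n, so j is well-defined; (b) j is strictly monotone; (c) P (j n) ≥ R n for all n; and (d) the stream n ↦ P (j n) is monotone and tends to infinity (it is again a time stream). -/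
/-- A divergent stream has a least index, among those from `k` on, at which it reaches `r`. -/
theorem exists_least_release {P : ℕ → ℝ} (hP : Filter.Tendsto P Filter.atTop Filter.atTop)
    (r : ℝ) (k : ℕ) :
    ∃ m, (k ≤ m ∧ r ≤ P m) ∧ ∀ m', k ≤ m' → r ≤ P m' → m ≤ m' := by
  classical
  have h : ∃ m, k ≤ m ∧ r ≤ P m :=
    ((Filter.eventually_ge_atTop k).and (hP.eventually_ge_atTop r)).exists
  exact ⟨Nat.find h, Nat.find_spec h, fun m' hk hr => Nat.find_min' h ⟨hk, hr⟩⟩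

/-- Well-definedness and timing determinism of the `ready` function: given a
release pattern `P` (monotone, divergent) and data-ready times `R`, the stream
`j` of indices selecting, for each `R n`, the first not-yet-used release point
of `P` at or after `R n`, is uniquely defined; it is strictly monotone,
satisfies `R n ≤ P (j n)`, and `P ∘ j` is again a time stream (monotone and
divergent). -/
theorem ready_well_defined (P R : ℕ → ℝ) (hPmono : Monotone P)
    (hPdiv : Filter.Tendsto P Filter.atTop Filter.atTop) :
    (∃! j : ℕ → ℕ,
      (R 0 ≤ P (j 0) ∧ ∀ m, R 0 ≤ P m → j 0 ≤ m) ∧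
      (∀ n, (j n < j (n + 1) ∧ R (n + 1) ≤ P (j (n + 1))) ∧
        ∀ m, j n < m → R (n + 1) ≤ P m → j (n + 1) ≤ m)) ∧
    (∀ j : ℕ → ℕ,
      ((R 0 ≤ P (j 0) ∧ ∀ m, R 0 ≤ P m → j 0 ≤ m) ∧
       (∀ n, (j n < j (n + 1) ∧ R (n + 1) ≤ P (j (n + 1))) ∧
         ∀ m, j n < m → R (n + 1) ≤ P m → j (n + 1) ≤ m)) →
      StrictMono j ∧ (∀ n, R n ≤ P (j n)) ∧ Monotone (fun n => P (j n)) ∧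
        Filter.Tendsto (fun n => P (j n)) Filter.atTop Filter.atTop) := by
  refine ⟨?_, ?_⟩
  · choose f hf hmin using fun a => exists_least_release hPdiv (R a)
    refine ⟨fun n => Nat.rec (f 0 0) (fun n k => f (n + 1) (k + 1)) n,
      ⟨⟨(hf 0 0).2, fun m => hmin 0 0 m m.zero_le⟩, fun n => ⟨hf _ _, fun m => hmin _ _ m⟩⟩, ?_⟩
    rintro j ⟨⟨h0, h0min⟩, hsucc⟩
    funext n
    induction n with
    | zero => exact le_antisymm (h0min _ (hf 0 0).2) (hmin 0 0 _ (Nat.zero_le _) h0)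
    | succ n ih =>
      obtain ⟨⟨hlt, hR⟩, hleast⟩ := hsucc n
      rw [ih] at hlt hleast
      exact le_antisymm (hleast _ (hf _ _).1 (hf _ _).2) (hmin _ _ _ hlt hR)
  · rintro j ⟨⟨h0, -⟩, hsucc⟩
    have hj : StrictMono j := strictMono_nat_of_lt_succ fun n => (hsucc n).1.1
    refine ⟨hj, fun n => ?_, hPmono.comp hj.monotone, hPdiv.comp hj.tendsto_atTop⟩
    cases n with
    | zero => exact h0
    | succ n => exact (hsucc n).1.2
end

section
/- Well-definedness and determinism of the register-read function 'sens': let T : ℕ → ℝ be monotone and tend to infinity (times at which values are written to the register), and let R : ℕ → ℝ be monotone and tend to infinity (times at which the register is read), with T 0 < R 0 (the register holds an initial value before the first read). Then: (a) for every n, the set {j : ℕ | T j < R n} is nonempty and finite, hence has a greatest element i n; (b) the function i : ℕ → ℕ is monotone and tends to infinity; (c) T (i n) < R n for all n; and (d) the stream n ↦ T (i n) is monotone. Consequently, the value read at the n-th read time, namely the most recently written value S (i n) for any data stream S : ℕ → α, is uniquely determined by the timed input stream and the read times. -/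
/-- Well-definedness and determinism of the register-read function `sens`:
given write times `T` and read times `R` (both time streams) with
`T 0 < R 0`, the index `i n` of the most recent value written strictly before
each read time `R n` is well-defined (the set `{j | T j < R n}` is nonempty
and finite, with greatest element `i n`); `i` is monotone and divergent,
`T (i n) < R n`, `n ↦ T (i n)` is monotone, and the value read at each read
time is uniquely determined. -/
theorem sens_well_defined {α : Type*} (T R : ℕ → ℝ)
    (hT : Monotone T) (hTdiv : Filter.Tendsto T Filter.atTop Filter.atTop)
    (hR : Monotone R) (hRdiv : Filter.Tendsto R Filter.atTop Filter.atTop)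
    (h0 : T 0 < R 0) :
    ∃ i : ℕ → ℕ,
      (∀ n, {j : ℕ | T j < R n}.Nonempty ∧ {j : ℕ | T j < R n}.Finite ∧
        T (i n) < R n ∧ ∀ j, T j < R n → j ≤ i n) ∧
      Monotone i ∧ Filter.Tendsto i Filter.atTop Filter.atTop ∧
      Monotone (fun n => T (i n)) ∧
      (∀ (S : ℕ → α) (i' : ℕ → ℕ),
        (∀ n, T (i' n) < R n ∧ ∀ j, T j < R n → j ≤ i' n) →
        ∀ n, S (i' n) = S (i n)) := by
  have hne (n : ℕ) : {j : ℕ | T j < R n}.Nonempty := ⟨0, h0.trans_le (hR (Nat.zero_le n))⟩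
  have hfin (n : ℕ) : {j : ℕ | T j < R n}.Finite := by
    obtain ⟨N, hN⟩ := (hTdiv.eventually_ge_atTop (R n)).exists
    refine (Set.finite_lt_nat N).subset fun j hj => ?_
    by_contra h
    exact (hN.trans (hT (not_lt.mp h))).not_gt hj
  choose i hi hmax using fun n => (hfin n).isCompact.exists_isGreatest (hne n)
  have hmono : Monotone i := fun m n hmn => hmax n ((hi m).trans_le (hR hmn))
  refine ⟨i, fun n => ⟨hne n, hfin n, hi n, fun j hj => hmax n hj⟩, hmono, ?_,
    hT.comp hmono, fun S i' h n => ?_⟩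
  · refine Filter.tendsto_atTop_atTop_of_monotone hmono fun b => ?_
    obtain ⟨n, hn⟩ := (hRdiv.eventually_gt_atTop (T b)).exists
    exact ⟨n, hmax n hn⟩
  · exact congrArg S ((hmax n (h n).1).antisymm ((h n).2 _ (hi n)))
end

section
/- Well-definedness and determinism of the timed merge assignment: let T : ℕ → ℝ be monotone (arrival times of the items of one input FIFO) and let R : ℕ → ℝ be monotone and tend to infinity (activation times of the merge node). Define k : ℕ → ℕ by k j = the least k with T j < R k. Then: (a) k j exists for every j, so k is well-defined; (b) k is monotone; (c) R (k j) > T j for all j (every item is output strictly after its arrival); (d) the stream of output time stamps j ↦ R (k j) is monotone; and (e) if moreover T tends to infinity, then k tends to infinity (every activation handles only finitely many items, and every item is eventually output). -/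
/-- Well-definedness and determinism of the timed merge assignment: given
arrival times `T` (monotone) of the items of one input FIFO and activation
times `R` (monotone, divergent) of the merge node, the assignment `k j` of
each item `j` to the least activation with `T j < R (k j)` is uniquely
defined; it is monotone, every item is output strictly after its arrival, the
output time stamps `j ↦ R (k j)` are monotone, and if `T` diverges then so
does `k`. -/
theorem merge_assignment_well_defined (T R : ℕ → ℝ)
    (hT : Monotone T) (hR : Monotone R)
    (hRdiv : Filter.Tendsto R Filter.atTop Filter.atTop) :
    ∃ k : ℕ → ℕ,
      (∀ j, T j < R (k j) ∧ ∀ m, T j < R m → k j ≤ m) ∧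
      (∀ k' : ℕ → ℕ, (∀ j, T j < R (k' j) ∧ ∀ m, T j < R m → k' j ≤ m) →
        k' = k) ∧
      Monotone k ∧
      (∀ j, T j < R (k j)) ∧
      Monotone (fun j => R (k j)) ∧
      (Filter.Tendsto T Filter.atTop Filter.atTop →
        Filter.Tendsto k Filter.atTop Filter.atTop) := by
  have hex : ∀ j, ∃ m, T j < R m := fun j => (hRdiv.eventually_gt_atTop (T j)).exists
  classical
  have hlt : ∀ j, T j < R (Nat.find (hex j)) := fun j => Nat.find_spec (hex j)
  have hmin : ∀ j m, T j < R m → Nat.find (hex j) ≤ m := fun j _ hm => Nat.find_min' (hex j) hm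
  have hmono : Monotone fun j => Nat.find (hex j) := fun i j hij =>
    hmin i _ ((hT hij).trans_lt (hlt j))
  refine ⟨fun j => Nat.find (hex j), fun j => ⟨hlt j, hmin j⟩, fun k' hk' => ?_, hmono, hlt,
    hR.comp hmono, fun hTdiv => ?_⟩
  · funext j
    exact le_antisymm ((hk' j).2 _ (hlt j)) (hmin j _ (hk' j).1)
  · refine Filter.tendsto_atTop.2 fun N => ?_
    filter_upwards [hTdiv.eventually_ge_atTop (R N)] with j hj
    exact (hR.reflect_lt (hj.trans_lt (hlt j))).le
end
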